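/- arXiv:2305.18833 — 2 statements merged into one kernel-verified Lean document; each statement's English description precedes it below -/
import Mathlib

section
/- (Lowering operator, Theorem 2.1 for the Gaussian Fisher–Hartwig weight.) For every integer n ≥ 1 and every z ∈ ℂ with Im z ≠ 0, the monic orthogonal polynomials satisfy P_n′(z) + B_n(z)·P_n(z) = β_n·A_n(z)·P_{n−1}(z), where P_n′ denotes the derivative of the polynomial P_n and polynomials are evaluated at the complex point z. -/
open MeasureTheory Polynomial

/-- The Gaussian weight with Fisher–Hartwig root-type singularities at the points `t j`. -/
noncomputable def fisherHartwig {N : ℕ} (t γ : Fin N → ℝ) (x : ℝ) : ℝ :=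
  Real.exp (-x ^ 2) * ∏ j, |x - t j| ^ γ j

theorem eval_ofReal_map_algebraMap (p : ℝ[X]) (y : ℝ) :
    (p.map (algebraMap ℝ ℂ)).eval (y : ℂ) = (p.eval y : ℝ) := by
  rw [eval_map_algebraMap]
  exact aeval_algebraMap_apply ℂ y p

theorem integrable_abs_rpow_mul_exp_neg_mul_sq {b : ℝ} (hb : 0 < b) {s : ℝ} (hs : -1 < s) :
    Integrable fun x : ℝ => |x| ^ s * Real.exp (-b * x ^ 2) := by
  have h1 : IntegrableOn (fun x : ℝ => |x| ^ s * Real.exp (-b * x ^ 2)) (Set.Ioi 0) := by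
    refine (integrableOn_rpow_mul_exp_neg_mul_sq hb hs).congr_fun (fun x hx => ?_)
      measurableSet_Ioi
    simp only [abs_of_pos (Set.mem_Ioi.1 hx)]
  have h2 : IntegrableOn (fun x : ℝ => |x| ^ s * Real.exp (-b * x ^ 2)) (Set.Iio 0) := by
    have := h1
    rw [← neg_zero (G := ℝ)] at this
    simpa using this.comp_neg_Iio
  rw [← integrableOn_univ, ← Set.Iio_union_Ici (a := (0 : ℝ))]
  exact h2.union (integrableOn_Ici_iff_integrableOn_Ioi (by simp) |>.2 h1)

theorem integrable_eval_mul_abs_rpow_mul_exp_neg_mul_sq {b : ℝ} (hb : 0 < b) {s : ℝ}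
    (hs : -1 < s) (q : ℂ[X]) :
    Integrable fun x : ℝ => q.eval (x : ℂ) * ((|x| ^ s * Real.exp (-b * x ^ 2) : ℝ) : ℂ) := by
  induction q using Polynomial.induction_on' with
  | add p q hp hq =>
    simp only [eval_add, add_mul]
    exact hp.add hq
  | monomial k a =>
    have h1 := (integrable_abs_rpow_mul_exp_neg_mul_sq hb
      (lt_of_lt_of_le hs (le_add_of_nonneg_right k.cast_nonneg))).const_mul ‖a‖
    refine h1.mono' (by
      simp only [eval_monomial]
      exact Measurable.aestronglyMeasurable (by fun_prop)) ?_
    filter_upwards [Measure.ae_ne volume (0 : ℝ)] with x hx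
    rw [Real.rpow_add_natCast (abs_ne_zero.2 hx)]
    simp only [eval_monomial, norm_mul, norm_pow, Complex.norm_real, Real.norm_eq_abs,
      Real.abs_exp, abs_of_nonneg (Real.rpow_nonneg (abs_nonneg x) s)]
    exact le_of_eq (by ring)

section FisherHartwig
variable {N : ℕ} {t γ : Fin N → ℝ}

theorem abs_rpow_le_one_add_pow {γ : ℝ} (hγ : 0 < γ) (x : ℝ) :
    |x| ^ γ ≤ 1 + x ^ (2 * ⌈γ⌉₊) := by
  rw [pow_mul, ← sq_abs, ← pow_mul]
  rcases le_total |x| 1 with hx | hx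
  · exact (Real.rpow_le_one (abs_nonneg x) hx hγ.le).trans (by simp)
  · calc |x| ^ γ ≤ |x| ^ ((2 * ⌈γ⌉₊ : ℕ) : ℝ) := by
          refine Real.rpow_le_rpow_of_exponent_le hx ?_
          push_cast
          linarith [Nat.le_ceil γ]
      _ ≤ 1 + |x| ^ (2 * ⌈γ⌉₊) := by rw [Real.rpow_natCast]; linarith

theorem continuous_fisherHartwig (hγ : ∀ j, 0 < γ j) : Continuous (fisherHartwig t γ) := by
  unfold fisherHartwig
  refine (by fun_prop : Continuous fun x : ℝ => Real.exp (-x ^ 2)).mul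
    (continuous_finsetProd _ fun j _ => ?_)
  exact (by fun_prop : Continuous fun x : ℝ => |x - t j|).rpow_const fun x => Or.inr (hγ j).le

theorem fisherHartwig_nonneg (x : ℝ) : 0 ≤ fisherHartwig t γ x := by
  unfold fisherHartwig
  positivity

/-- The weight divided by one of its singular factors has finite moments of all orders. -/
theorem integrable_eval_mul_fisherHartwig_div (hγ : ∀ j, 0 < γ j) (q : ℂ[X]) (j : Fin N) :
    Integrable fun y : ℝ => q.eval (y : ℂ) * ((fisherHartwig t γ y / (y - t j) : ℝ) : ℂ) := by
  classical
  let R : ℝ[X] := C (Real.exp (t j ^ 2)) *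
    ∏ i ∈ Finset.univ.erase j, (1 + (X - C (t i)) ^ (2 * ⌈γ i⌉₊))
  have h1 := ((integrable_eval_mul_abs_rpow_mul_exp_neg_mul_sq (b := 1 / 2) (by norm_num)
    (by linarith [hγ j] : -1 < γ j - 1)
    ((q * R.map (algebraMap ℝ ℂ)).comp (X + C (t j : ℂ)))).comp_sub_right (t j)).norm
  refine h1.mono' ?_ ?_
  · have := (continuous_fisherHartwig (t := t) hγ).measurable
    exact Measurable.aestronglyMeasurable (by
      refine Measurable.mul (q.continuous.comp Complex.continuous_ofReal).measurable ?_
      fun_prop)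
  · refine Filter.Eventually.of_forall fun y => ?_
    rcases eq_or_ne y (t j) with rfl | hy
    · rw [sub_self, div_zero, Complex.ofReal_zero, mul_zero, norm_zero]
      exact norm_nonneg _
    have hpos : 0 < |y - t j| := abs_pos.2 (sub_ne_zero.2 hy)
    simp only [eval_comp, eval_add, eval_X, eval_C, eval_mul, Complex.ofReal_sub, sub_add_cancel,
      eval_ofReal_map_algebraMap, norm_mul, mul_assoc, Complex.norm_real]
    refine mul_le_mul_of_nonneg_left ?_ (norm_nonneg _)
    have hprod : ∏ i ∈ Finset.univ.erase j, |y - t i| ^ γ i ≤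
        ∏ i ∈ Finset.univ.erase j, (1 + (y - t i) ^ (2 * ⌈γ i⌉₊)) :=
      Finset.prod_le_prod (fun i _ => by positivity) fun i _ => abs_rpow_le_one_add_pow (hγ i) _
    have hexp : Real.exp (-y ^ 2) ≤
        Real.exp (t j ^ 2) * Real.exp (-(1 / 2) * (y - t j) ^ 2) := by
      rw [← Real.exp_add]
      exact Real.exp_le_exp.2 (by nlinarith [sq_nonneg (y + t j)])
    have hw : ‖fisherHartwig t γ y / (y - t j)‖ = Real.exp (-y ^ 2) * |y - t j| ^ (γ j - 1) *
        ∏ i ∈ Finset.univ.erase j, |y - t i| ^ γ i := by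
      rw [norm_div, Real.norm_of_nonneg (fisherHartwig_nonneg y), fisherHartwig,
        ← Finset.mul_prod_erase _ _ (Finset.mem_univ j), Real.rpow_sub_one hpos.ne',
        Real.norm_eq_abs]
      ring
    have hRy : R.eval y = Real.exp (t j ^ 2) *
        ∏ i ∈ Finset.univ.erase j, (1 + (y - t i) ^ (2 * ⌈γ i⌉₊)) := by
      simp [R, eval_prod]
    have hnn : 0 ≤ ∏ i ∈ Finset.univ.erase j, (1 + (y - t i) ^ (2 * ⌈γ i⌉₊)) :=
      Finset.prod_nonneg fun i _ => by rw [pow_mul]; positivity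
    rw [hw, hRy, Real.norm_of_nonneg (mul_nonneg (Real.exp_nonneg _) hnn),
      Real.norm_of_nonneg (by positivity : 0 ≤ |y - t j| ^ (γ j - 1)),
      Real.norm_of_nonneg (Real.exp_nonneg _)]
    calc _ ≤ (Real.exp (t j ^ 2) * Real.exp (-(1 / 2) * (y - t j) ^ 2)) *
          |y - t j| ^ (γ j - 1) * ∏ i ∈ Finset.univ.erase j, (1 + (y - t i) ^ (2 * ⌈γ i⌉₊)) := by
          gcongr
      _ = _ := by ring

theorem integrable_eval_mul_fisherHartwig (hN : 1 ≤ N) (hγ : ∀ j, 0 < γ j) (q : ℂ[X]) :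
    Integrable fun y : ℝ => q.eval (y : ℂ) * (fisherHartwig t γ y : ℂ) := by
  let j : Fin N := ⟨0, hN⟩
  refine (integrable_eval_mul_fisherHartwig_div (t := t) hγ ((X - C (t j : ℂ)) * q) j).congr ?_
  filter_upwards [Measure.ae_ne volume (t j)] with y hy
  have : (y : ℂ) - t j ≠ 0 := sub_ne_zero.2 (by exact_mod_cast hy)
  simp only [eval_mul, eval_sub, eval_X, eval_C]
  push_cast
  field_simp

theorem hasDerivAt_fisherHartwig {y : ℝ} (hy : ∀ j, y ≠ t j) :
    HasDerivAt (fisherHartwig t γ)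
      (-2 * y * fisherHartwig t γ y + ∑ j, γ j * (fisherHartwig t γ y / (y - t j))) y := by
  classical
  have hf : ∀ j ∈ Finset.univ, HasDerivAt (fun x : ℝ => |x - t j| ^ γ j)
      (γ j * (|y - t j| ^ γ j / (y - t j))) y := fun j _ => by
    have hne : y - t j ≠ 0 := sub_ne_zero.2 (hy j)
    have habs : HasDerivAt (fun x : ℝ => |x - t j|) (SignType.sign (y - t j) : ℝ) y := by
      exact ((hasDerivAt_abs hne).comp y ((hasDerivAt_id y).sub_const (t j))).congr_deriv
        (mul_one _)
    refine (habs.rpow_const (p := γ j) (Or.inl (abs_ne_zero.2 hne))).congr_deriv ?_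
    rw [Real.rpow_sub_one (abs_ne_zero.2 hne)]
    rcases lt_or_gt_of_ne hne with h | h
    · rw [sign_neg h, abs_of_neg h, SignType.coe_neg_one, div_neg]
      ring
    · rw [sign_pos h, abs_of_pos h, SignType.coe_one]
      ring
  have he : HasDerivAt (fun x : ℝ => Real.exp (-x ^ 2)) (Real.exp (-y ^ 2) * (-(2 * y))) y := by
    simpa using ((hasDerivAt_pow 2 y).neg).exp
  refine (he.mul (HasDerivAt.fun_finsetProd hf)).congr_deriv ?_
  rw [Finset.mul_sum]
  congr 1
  · rw [fisherHartwig]; ring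
  · refine Finset.sum_congr rfl fun j _ => ?_
    rw [fisherHartwig, ← Finset.mul_prod_erase _ _ (Finset.mem_univ j), smul_eq_mul]
    ring

theorem integral_fisherHartwig_by_parts (hN : 1 ≤ N) (hγ : ∀ j, 0 < γ j) (q : ℂ[X]) :
    (∫ y : ℝ, (derivative q).eval (y : ℂ) * (fisherHartwig t γ y : ℂ)) -
      2 * (∫ y : ℝ, (X * q).eval (y : ℂ) * (fisherHartwig t γ y : ℂ)) +
      ∑ j, (γ j : ℂ) *
        ∫ y : ℝ, q.eval (y : ℂ) * ((fisherHartwig t γ y / (y - t j) : ℝ) : ℂ) = 0 := by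
  have h1 := integrable_eval_mul_fisherHartwig (t := t) hN hγ (derivative q)
  have h2 := (integrable_eval_mul_fisherHartwig (t := t) hN hγ (X * q)).const_mul 2
  have h3 := fun j => (integrable_eval_mul_fisherHartwig_div (t := t) hγ q j).const_mul (γ j : ℂ)
  have h4 := integrable_finsetSum Finset.univ fun j _ => h3 j
  let f : ℝ → ℂ := fun y => q.eval (y : ℂ) * (fisherHartwig t γ y : ℂ)
  let f' : ℝ → ℂ := fun y => (derivative q).eval (y : ℂ) * (fisherHartwig t γ y : ℂ) -
    2 * ((X * q).eval (y : ℂ) * (fisherHartwig t γ y : ℂ)) +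
    ∑ j, (γ j : ℂ) * (q.eval (y : ℂ) * ((fisherHartwig t γ y / (y - t j) : ℝ) : ℂ))
  have hf : Integrable f := integrable_eval_mul_fisherHartwig hN hγ q
  have hf' : Integrable f' := (h1.sub h2).add h4
  have hderiv : ∀ y : ℝ, (∀ j, y ≠ t j) → HasDerivAt f (f' y) y := fun y hy => by
    have := ((q.hasDerivAt (y : ℂ)).comp_ofReal).mul
      (hasDerivAt_fisherHartwig (γ := γ) hy).ofReal_comp
    refine this.congr_deriv ?_
    simp only [f', eval_mul, eval_X]
    push_cast
    rw [mul_add, Finset.mul_sum, ← add_assoc]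
    congr 1
    · ring
    · exact Finset.sum_congr rfl fun j _ => by ring
  have hcont : Continuous f := (q.continuous.comp Complex.continuous_ofReal).mul
    (Complex.continuous_ofReal.comp (continuous_fisherHartwig hγ))
  obtain ⟨a, ha⟩ : ∃ a : ℝ, ∀ j, |t j| < a := by
    obtain ⟨a, ha⟩ := (Set.finite_range fun j => |t j|).bddAbove
    exact ⟨a + 1, fun j => (ha ⟨j, rfl⟩).trans_lt (lt_add_one a)⟩
  have htop : Filter.Tendsto f Filter.atTop (nhds 0) :=
    tendsto_zero_of_hasDerivAt_of_integrableOn_Ioi (a := a) (fun y hy => hderiv y fun j e => by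
      have := (abs_lt.1 (ha j)).2
      simp only [Set.mem_Ioi] at hy; linarith) hf'.integrableOn hf.integrableOn
  have hbot : Filter.Tendsto f Filter.atBot (nhds 0) :=
    tendsto_zero_of_hasDerivAt_of_integrableOn_Iic (a := -a) (fun y hy => hderiv y fun j e => by
      have := (abs_lt.1 (ha j)).1
      simp only [Set.mem_Iic] at hy; linarith) hf'.integrableOn hf.integrableOn
  have hlim := intervalIntegral_tendsto_integral hf' Filter.tendsto_neg_atTop_atBot
    Filter.tendsto_id
  have hFTC : ∀ r : ℝ, ∫ y in (-r)..(id r), f' y = f r - f (-r) := fun r =>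
    integral_eq_of_hasDerivAt_off_countable f f' (Set.finite_range t).countable
      hcont.continuousOn (fun y hy => hderiv y fun j e => hy.2 ⟨j, e.symm⟩)
      hf'.intervalIntegrable
  simp only [hFTC] at hlim
  have h0 := tendsto_nhds_unique hlim
    (htop.sub (hbot.comp Filter.tendsto_neg_atTop_atBot))
  rw [sub_zero] at h0
  have hsplit : ∫ y, f' y = _ := integral_add (h1.sub h2) h4
  rw [hsplit, integral_finsetSum _ fun j _ => h3 j] at h0
  have hsub := integral_sub h1 h2
  simp only [integral_const_mul] at h0 hsub
  rwa [hsub] at h0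

/-- Integration of complex polynomials against the Fisher–Hartwig weight. -/
noncomputable def momentFunctional (hN : 1 ≤ N) (hγ : ∀ j, 0 < γ j) (t : Fin N → ℝ) :
    ℂ[X] →ₗ[ℂ] ℂ where
  toFun q := ∫ y : ℝ, q.eval (y : ℂ) * (fisherHartwig t γ y : ℂ)
  map_add' p q := by
    simp only [eval_add, add_mul]
    exact integral_add (integrable_eval_mul_fisherHartwig hN hγ p)
      (integrable_eval_mul_fisherHartwig hN hγ q)
  map_smul' c q := by
    simp only [eval_smul, smul_eq_mul, mul_assoc, integral_const_mul, RingHom.id_apply]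

theorem momentFunctional_map_mul_map (hN : 1 ≤ N) (hγ : ∀ j, 0 < γ j) (p q : ℝ[X]) :
    momentFunctional hN hγ t (p.map (algebraMap ℝ ℂ) * q.map (algebraMap ℝ ℂ)) =
      ((∫ y : ℝ, p.eval y * q.eval y * fisherHartwig t γ y : ℝ) : ℂ) := by
  rw [← integral_complex_ofReal]
  simp only [momentFunctional, LinearMap.coe_mk, AddHom.coe_mk, eval_mul,
    eval_ofReal_map_algebraMap, Complex.ofReal_mul]

/-- A real polynomial of positive norm that is orthogonal to all polynomials of smaller degree
has no zero off the real line. -/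
theorem eval_ne_zero_of_orthogonal (hN : 1 ≤ N) (hγ : ∀ j, 0 < γ j) {p : ℝ[X]}
    (horth : ∀ q : ℂ[X], q.degree < p.natDegree →
      momentFunctional hN hγ t (q * p.map (algebraMap ℝ ℂ)) = 0)
    (hpos : 0 < ∫ y : ℝ, (p.eval y) ^ 2 * fisherHartwig t γ y) {z : ℂ} (hz : z.im ≠ 0) :
    (p.map (algebraMap ℝ ℂ)).eval z ≠ 0 := by
  intro h0
  obtain ⟨r, hr⟩ : X - C z ∣ p.map (algebraMap ℝ ℂ) := dvd_iff_isRoot.2 h0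
  have hr0 : r ≠ 0 := by
    rintro rfl
    rw [mul_zero, Polynomial.map_eq_zero] at hr
    simp [hr] at hpos
  have hdeg : r.natDegree + 1 = p.natDegree := by
    rw [← natDegree_map (algebraMap ℝ ℂ) (p := p), hr,
      natDegree_mul (X_sub_C_ne_zero z) hr0, natDegree_X_sub_C, add_comm]
  have hconj (y : ℝ) : (r.map (starRingEnd ℂ)).eval (y : ℂ) = starRingEnd ℂ (r.eval (y : ℂ)) := by
    conv_lhs => rw [← Complex.conj_ofReal y]
    rw [eval_map_apply]
  have hnorm (y : ℝ) : r.eval (y : ℂ) * starRingEnd ℂ (r.eval (y : ℂ)) =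
      ((Complex.normSq (r.eval (y : ℂ)) : ℝ) : ℂ) := Complex.mul_conj _
  have hL := horth (r.map (starRingEnd ℂ)) (by
    rw [degree_map, degree_eq_natDegree hr0]; exact_mod_cast (by omega))
  have hint := integrable_eval_mul_fisherHartwig (t := t) hN hγ (r.map (starRingEnd ℂ) * r)
  have him : ∫ y : ℝ, Complex.normSq (r.eval (y : ℂ)) * fisherHartwig t γ y = 0 := by
    have hint' := integrable_eval_mul_fisherHartwig (t := t) hN hγ
      (r.map (starRingEnd ℂ) * p.map (algebraMap ℝ ℂ))
    have h1 := congrArg Complex.im hL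
    change Complex.im (∫ y : ℝ, _) = 0 at h1
    rw [← RCLike.im_eq_complex_im, ← integral_im hint'] at h1
    have h2 : ∀ y : ℝ, RCLike.im
        ((r.map (starRingEnd ℂ) * p.map (algebraMap ℝ ℂ)).eval (y : ℂ) *
          (fisherHartwig t γ y : ℂ)) =
        -z.im * (Complex.normSq (r.eval (y : ℂ)) * fisherHartwig t γ y) := fun y => by
      have h3 : (r.map (starRingEnd ℂ) * p.map (algebraMap ℝ ℂ)).eval (y : ℂ) *
          (fisherHartwig t γ y : ℂ) = ((y : ℂ) - z) *
          ((Complex.normSq (r.eval (y : ℂ)) * fisherHartwig t γ y : ℝ) : ℂ) := by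
        rw [hr, eval_mul, eval_mul, hconj, Complex.ofReal_mul, ← hnorm]
        simp only [eval_sub, eval_X, eval_C]
        ring
      rw [h3, RCLike.im_eq_complex_im, Complex.im_mul_ofReal]
      simp
    simp only [h2, integral_const_mul] at h1
    exact (mul_eq_zero.1 h1).resolve_left (neg_ne_zero.2 hz)
  have hint2 : Integrable fun y : ℝ =>
      Complex.normSq (r.eval (y : ℂ)) * fisherHartwig t γ y := by
    refine hint.re.congr (Filter.Eventually.of_forall fun y => ?_)
    simp only [eval_mul, hconj]
    rw [mul_comm (starRingEnd ℂ _), hnorm, ← Complex.ofReal_mul]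
    rfl
  have hae := (integral_eq_zero_iff_of_nonneg
    (fun y => mul_nonneg (Complex.normSq_nonneg _) (fisherHartwig_nonneg y)) hint2).1 him
  refine hpos.ne' (integral_eq_zero_of_ae ?_)
  filter_upwards [hae] with y hy
  rcases mul_eq_zero.1 hy with h | h
  · have h4 : ((p.eval y : ℝ) : ℂ) = 0 := by
      rw [← eval_ofReal_map_algebraMap, hr, eval_mul, Complex.normSq_eq_zero.1 h, mul_zero]
    simp [Complex.ofReal_eq_zero.1 h4]
  · simp [h]

theorem integrable_eval_mul_fisherHartwig_div_mul_inv (hγ : ∀ j, 0 < γ j) (q : ℂ[X])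
    (j : Fin N) {z : ℂ} (hz : z.im ≠ 0) :
    Integrable fun y : ℝ => q.eval (y : ℂ) * (fisherHartwig t γ y : ℂ) /
      (((y : ℂ) - (t j : ℂ)) * (z - (y : ℂ))) := by
  refine ((integrable_eval_mul_fisherHartwig_div (t := t) hγ q j).mul_bdd
    (f := _) (g := fun y : ℝ => (z - (y : ℂ))⁻¹) (c := |z.im|⁻¹)
    (Measurable.aestronglyMeasurable (by fun_prop))
    (Filter.Eventually.of_forall fun y => ?_)).congr (Filter.Eventually.of_forall fun y => ?_)
  · rw [norm_inv]
    refine inv_anti₀ (abs_pos.2 hz) ?_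
    simpa using Complex.abs_im_le_norm (z - y)
  · push_cast
    simp only [div_eq_mul_inv, mul_inv]
    ring

end FisherHartwig

section Algebra
variable {K : Type*} [Field K] {L : K[X] →ₗ[K] K} {p : ℕ → K[X]}

theorem map_mul_orthogonal_eq_zero (hmonic : ∀ n, (p n).Monic) (hdeg : ∀ n, (p n).natDegree = n)
    (horth : ∀ m n, m ≠ n → L (p m * p n) = 0) {n : ℕ} (q : K[X]) (hq : q.degree < n) :
    L (q * p n) = 0 := by
  induction hd : q.degree using WellFoundedLT.induction generalizing q with
  | ind d ih =>
    subst hd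
    rcases eq_or_ne q 0 with rfl | h0
    · simp
    have hlt : q.natDegree < n := (natDegree_lt_iff_degree_lt h0).2 hq
    have hlc : q.leadingCoeff ≠ 0 := leadingCoeff_ne_zero.2 h0
    have hsub : (q - C q.leadingCoeff * p q.natDegree).degree < q.degree := by
      refine degree_sub_lt_left ?_ h0 ?_
      · rw [degree_C_mul hlc, degree_eq_natDegree (hmonic _).ne_zero, hdeg,
          degree_eq_natDegree h0]
      · rw [leadingCoeff_mul, leadingCoeff_C, (hmonic _).leadingCoeff, mul_one]
    have := ih _ hsub _ (hsub.trans hq) rfl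
    rwa [sub_mul, mul_assoc, map_sub, C_mul', map_smul, horth _ _ hlt.ne, smul_zero,
      sub_zero] at this

theorem map_mul_orthogonal_eq_coeff (hmonic : ∀ n, (p n).Monic)
    (hdeg : ∀ n, (p n).natDegree = n)
    (horth : ∀ m n, m ≠ n → L (p m * p n) = 0) {n : ℕ} (q : K[X]) (hq : q.degree ≤ n) :
    L (q * p n) = q.coeff n * L (p n * p n) := by
  have hlt : (q - C (q.coeff n) * p n).degree < n := by
    rw [degree_lt_iff_coeff_zero]
    intro m hm
    rw [coeff_sub, coeff_C_mul]
    rcases hm.eq_or_lt with rfl | hm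
    · have := (hmonic n).coeff_natDegree
      rw [hdeg] at this
      rw [this, mul_one, sub_self]
    · rw [coeff_eq_zero_of_degree_lt (hq.trans_lt (by exact_mod_cast hm)),
        coeff_eq_zero_of_natDegree_lt ((hdeg n).trans_lt hm), mul_zero, sub_zero]
  have := map_mul_orthogonal_eq_zero hmonic hdeg horth _ hlt
  rwa [sub_mul, mul_assoc, map_sub, C_mul', map_smul, smul_eq_mul, sub_eq_zero] at this

/-- The Christoffel–Darboux quotient: it has degree at most `n`, its coefficient at `X ^ n` is
`(p n).eval z`, and it is a multiple of the reproducing kernel at `z`. -/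
theorem exists_christoffelDarboux_quotient (hmonic : ∀ n, (p n).Monic)
    (hdeg : ∀ n, (p n).natDegree = n) (horth : ∀ m n, m ≠ n → L (p m * p n) = 0)
    (n : ℕ) {z : K} (hz : (p n).eval z ≠ 0) :
    ∃ ψ : K[X], (X - C z) * ψ = p (n + 1) * C ((p n).eval z) - p n * C ((p (n + 1)).eval z) ∧
      ψ.degree ≤ n ∧ ψ.coeff n = (p n).eval z ∧
      ∀ q : K[X], q.degree ≤ n → L (q * ψ) = q.eval z * L (p n * p n) := by
  set F := p (n + 1) * C ((p n).eval z) - p n * C ((p (n + 1)).eval z) with hF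
  obtain ⟨ψ, hψ⟩ : X - C z ∣ F := dvd_iff_isRoot.2 (by simp [hF, mul_comm])
  have hFdeg : F.natDegree ≤ n + 1 := by
    refine (natDegree_sub_le _ _).trans (max_le ?_ ?_)
    · exact (natDegree_mul_C_le _ _).trans (hdeg _).le
    · exact (natDegree_mul_C_le _ _).trans ((hdeg _).le.trans n.le_succ)
  have hψdeg : ψ.natDegree ≤ n := by
    rcases eq_or_ne ψ 0 with rfl | h0
    · simp
    rw [hψ, natDegree_mul (X_sub_C_ne_zero z) h0, natDegree_X_sub_C] at hFdeg
    omega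
  have hcoeff : ψ.coeff n = (p n).eval z := by
    have h1 : F.coeff (n + 1) = (p n).eval z := by
      have h2 := (hmonic (n + 1)).coeff_natDegree
      rw [hdeg] at h2
      rw [hF, coeff_sub, coeff_mul_C, coeff_mul_C, h2,
        coeff_eq_zero_of_natDegree_lt ((hdeg n).trans_lt n.lt_succ_self)]
      simp
    rw [hψ, sub_mul, coeff_sub, coeff_X_mul, coeff_C_mul,
      coeff_eq_zero_of_natDegree_lt (Nat.lt_succ_of_le hψdeg), mul_zero, sub_zero] at h1
    exact h1
  have hψdeg' : ψ.degree ≤ n := natDegree_le_iff_degree_le.1 hψdeg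
  have hone : ∀ q : K[X], q.degree ≤ n → L (q * ψ) = q.eval z * L ψ := fun q hq => by
    obtain ⟨r, hr⟩ : X - C z ∣ q - C (q.eval z) := dvd_iff_isRoot.2 (by simp)
    have hrdeg : r.degree < n := by
      rcases eq_or_ne r 0 with rfl | h0
      · exact bot_lt_iff_ne_bot.2 (by simp)
      have h3 : (q - C (q.eval z)).natDegree ≤ n :=
        (natDegree_sub_C).trans_le (natDegree_le_iff_degree_le.2 hq)
      rw [hr, natDegree_mul (X_sub_C_ne_zero z) h0, natDegree_X_sub_C] at h3
      rw [← natDegree_lt_iff_degree_lt h0]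
      omega
    have hrF : L (r * F) = 0 := by
      have h4 : r * F = (p n).eval z • (r * p (n + 1)) - (p (n + 1)).eval z • (r * p n) := by
        rw [hF, smul_eq_C_mul, smul_eq_C_mul]; ring
      rw [h4, map_sub, map_smul, map_smul, map_mul_orthogonal_eq_zero hmonic hdeg horth r hrdeg,
        map_mul_orthogonal_eq_zero hmonic hdeg horth r
          (hrdeg.trans (by exact_mod_cast n.lt_succ_self))]
      simp
    have h5 : q * ψ = q.eval z • ψ + r * F := by
      rw [hψ, smul_eq_C_mul]; linear_combination ψ * hr
    rw [h5, map_add, hrF, map_smul, smul_eq_mul, add_zero]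
  have hL : L ψ = L (p n * p n) := by
    have h6 := hone (p n) (by rw [degree_eq_natDegree (hmonic n).ne_zero, hdeg])
    rw [mul_comm, map_mul_orthogonal_eq_coeff hmonic hdeg horth ψ hψdeg', hcoeff] at h6
    exact (mul_left_cancel₀ hz h6).symm
  exact ⟨ψ, hψ.symm, hψdeg', hcoeff, fun q hq => by rw [hone q hq, hL]⟩

end Algebra

theorem lowering_operator
    (N : ℕ) (hN : 1 ≤ N)
    (t γ : Fin N → ℝ) (ht : Function.Injective t) (hγ : ∀ j, 0 < γ j)
    (w : ℝ → ℝ) (hw : ∀ x : ℝ, w x = Real.exp (-x ^ 2) * ∏ j, |x - t j| ^ γ j)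
    (P : ℕ → Polynomial ℝ)
    (hPmonic : ∀ n, (P n).Monic) (hPdeg : ∀ n, (P n).natDegree = n)
    (horth : ∀ m n, m ≠ n → ∫ x : ℝ, (P m).eval x * (P n).eval x * w x = 0)
    (h : ℕ → ℝ) (hh : ∀ n, h n = ∫ x : ℝ, ((P n).eval x) ^ 2 * w x)
    (hhpos : ∀ n, 0 < h n)
    (β : ℕ → ℝ) (hβ0 : β 0 = 0) (hβ : ∀ n, β (n + 1) = h (n + 1) / h n)
    (α : ℕ → ℝ) (hα : ∀ n, α n = (∫ x : ℝ, x * ((P n).eval x) ^ 2 * w x) / h n)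
    (A B : ℕ → ℂ → ℂ)
    (hA : ∀ n (z : ℂ), A n z = 2 + ∑ j, ((γ j / h n : ℝ) : ℂ) *
      ∫ y : ℝ, (Complex.ofReal ((P n).eval y)) ^ 2 * (w y : ℂ) / (((y : ℂ) - (t j : ℂ)) * (z - (y : ℂ))))
    (hB0 : ∀ z : ℂ, B 0 z = 0)
    (hB : ∀ n (z : ℂ), B (n + 1) z = ∑ j, ((γ j / h n : ℝ) : ℂ) *
      ∫ y : ℝ, (Complex.ofReal ((P (n + 1)).eval y)) * (Complex.ofReal ((P n).eval y)) * (w y : ℂ) / (((y : ℂ) - (t j : ℂ)) * (z - (y : ℂ))))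
    (n : ℕ) (hn : 1 ≤ n) (z : ℂ) (hz : z.im ≠ 0) :
    Polynomial.aeval z (Polynomial.derivative (P n)) + B n z * Polynomial.aeval z (P n)
      = (β n : ℂ) * A n z * Polynomial.aeval z (P (n - 1)) := by
  obtain rfl : w = fisherHartwig t γ := funext hw
  obtain ⟨n, rfl⟩ : ∃ m, n = m + 1 := ⟨n - 1, by omega⟩
  let p : ℕ → ℂ[X] := fun m => (P m).map (algebraMap ℝ ℂ)
  let L := momentFunctional hN hγ t
  have hpmonic : ∀ m, (p m).Monic := fun m => (hPmonic m).map _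
  have hpdeg : ∀ m, (p m).natDegree = m := fun m => (natDegree_map _).trans (hPdeg m)
  have hporth : ∀ m k, m ≠ k → L (p m * p k) = 0 := fun m k hmk => by
    rw [momentFunctional_map_mul_map, horth m k hmk, Complex.ofReal_zero]
  have hpnorm : ∀ m, L (p m * p m) = (h m : ℂ) := fun m => by
    rw [momentFunctional_map_mul_map, hh]
    simp only [pow_two]
  have hzero : (p n).eval z ≠ 0 :=
    eval_ne_zero_of_orthogonal hN hγ (fun q hq => by
      rw [hPdeg] at hq
      exact map_mul_orthogonal_eq_zero hpmonic hpdeg hporth q hq) (hh n ▸ hhpos n) hz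
  obtain ⟨ψ, hψ, hψdeg, hψcoeff, hψker⟩ :=
    exists_christoffelDarboux_quotient hpmonic hpdeg hporth n hzero
  let I₁ : Fin N → ℂ := fun j => ∫ y : ℝ, (Complex.ofReal ((P (n + 1)).eval y)) ^ 2 *
    (fisherHartwig t γ y : ℂ) / (((y : ℂ) - (t j : ℂ)) * (z - (y : ℂ)))
  let I₂ : Fin N → ℂ := fun j => ∫ y : ℝ, (Complex.ofReal ((P (n + 1)).eval y)) *
    (Complex.ofReal ((P n).eval y)) * (fisherHartwig t γ y : ℂ) /
    (((y : ℂ) - (t j : ℂ)) * (z - (y : ℂ)))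
  have hI (j : Fin N) : ∫ y : ℝ, (p (n + 1) * ψ).eval (y : ℂ) *
      ((fisherHartwig t γ y / (y - t j) : ℝ) : ℂ) =
      (p (n + 1)).eval z * I₂ j - (p n).eval z * I₁ j := by
    have h1 := integrable_eval_mul_fisherHartwig_div_mul_inv (t := t) hγ
      (p (n + 1) * p (n + 1)) j hz
    have h2 := integrable_eval_mul_fisherHartwig_div_mul_inv (t := t) hγ
      (p (n + 1) * p n) j hz
    simp only [p, eval_mul, eval_ofReal_map_algebraMap] at h1 h2
    simp only [← pow_two] at h1
    rw [← integral_const_mul, ← integral_const_mul,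
      ← integral_sub (h2.const_mul _) (h1.const_mul _)]
    refine integral_congr_ae (Filter.Eventually.of_forall fun y => ?_)
    have hzy : z - (y : ℂ) ≠ 0 := fun e => hz (by simpa using congrArg Complex.im e)
    have hev := congrArg (eval (y : ℂ)) hψ
    simp only [eval_mul, eval_sub, eval_X, eval_C] at hev
    have hψy : ψ.eval (y : ℂ) = ((p n).eval (y : ℂ) * (p (n + 1)).eval z -
        (p (n + 1)).eval (y : ℂ) * (p n).eval z) / (z - y) := by
      rw [eq_div_iff hzy]
      linear_combination -hev
    simp only [eval_mul, hψy, ← eval_ofReal_map_algebraMap]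
    push_cast
    simp only [div_eq_mul_inv, mul_inv]
    ring
  have hparts := integral_fisherHartwig_by_parts (t := t) hN hγ (p (n + 1) * ψ)
  change L (derivative (p (n + 1) * ψ)) - 2 * L (X * (p (n + 1) * ψ)) + _ = 0 at hparts
  have hderiv : L (derivative (p (n + 1) * ψ)) = (derivative (p (n + 1))).eval z * h n := by
    rw [derivative_mul, map_add, mul_comm (p (n + 1)) (derivative ψ),
      map_mul_orthogonal_eq_zero hpmonic hpdeg hporth (derivative ψ)
        ((degree_derivative_le.trans hψdeg).trans_lt (by exact_mod_cast n.lt_succ_self)),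
      add_zero, hψker _ (natDegree_le_iff_degree_le.1
        ((natDegree_derivative_le _).trans (by rw [hpdeg]; exact le_rfl))), hpnorm]
  have hX : L (X * (p (n + 1) * ψ)) = (p n).eval z * h (n + 1) := by
    rw [mul_comm (p (n + 1)), ← mul_assoc,
      map_mul_orthogonal_eq_coeff hpmonic hpdeg hporth (X * ψ) (by
        refine (degree_mul_le _ _).trans ?_
        rw [degree_X, add_comm]
        push_cast
        gcongr), coeff_X_mul, hψcoeff, hpnorm]
  simp only [hderiv, hX, hI, mul_sub, Finset.sum_sub_distrib, mul_left_comm (γ _ : ℂ),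
    ← Finset.mul_sum] at hparts
  have hn0 : (h n : ℂ) ≠ 0 := Complex.ofReal_ne_zero.2 (hhpos n).ne'
  have hn1 : (h (n + 1) : ℂ) ≠ 0 := Complex.ofReal_ne_zero.2 (hhpos (n + 1)).ne'
  have hA' : A (n + 1) z = 2 + (∑ j, (γ j : ℂ) * I₁ j) / h (n + 1) := by
    rw [hA, Finset.sum_div]
    congr 1
    refine Finset.sum_congr rfl fun j _ => ?_
    rw [Complex.ofReal_div, div_mul_eq_mul_div]
  have hB' : B (n + 1) z = (∑ j, (γ j : ℂ) * I₂ j) / h n := by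
    rw [hB, Finset.sum_div]
    refine Finset.sum_congr rfl fun j _ => ?_
    rw [Complex.ofReal_div, div_mul_eq_mul_div]
  rw [hA', hB', hβ, Nat.add_sub_cancel, Complex.ofReal_div, ← eval_map_algebraMap,
    ← eval_map_algebraMap, ← eval_map_algebraMap, ← derivative_map]
  change eval z (derivative (p (n + 1))) + _ * eval z (p (n + 1)) = _ * eval z (p n)
  field_simp
  linear_combination hparts
end

section
/- (Raising operator, Theorem 2.1 for the Gaussian Fisher–Hartwig weight.) For every integer n ≥ 1 and every z ∈ ℂ with Im z ≠ 0, the monic orthogonal polynomials satisfy P_{n−1}′(z) − (B_n(z) + 2z)·P_{n−1}(z) = −A_{n−1}(z)·P_n(z), where P_{n−1}′ denotes the derivative of the polynomial P_{n−1} and polynomials are evaluated at the complex point z. -/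
open MeasureTheory Polynomial

section OrthogonalPolynomials

variable {K : Type*} [Field K] (L : K[X] →ₗ[K] K) {P : ℕ → K[X]}

theorem orthogonal_of_degree_lt (hmonic : ∀ n, (P n).Monic) (hdeg : ∀ n, (P n).natDegree = n)
    (horth : ∀ m n, m ≠ n → L (P m * P n) = 0) {m : ℕ} {r : K[X]} (hr : r.degree < m) :
    L (P m * r) = 0 := by
  suffices H : ∀ d ≤ m, ∀ r : K[X], r.degree < d → L (P m * r) = 0 from H m le_rfl r hr
  intro d
  induction d with
  | zero =>
    intro _ r hr
    have : r = 0 := by simpa using hr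
    simp [this]
  | succ d ih =>
    intro hd r hr
    have hlt : (r - C (r.coeff d) * P d).degree < d := by
      rw [degree_lt_iff_coeff_zero] at hr ⊢
      intro k hk
      rcases hk.eq_or_lt with rfl | hk
      · have : (P d).coeff d = 1 := by simpa [hdeg d] using (hmonic d).coeff_natDegree
        simp [this]
      · simp [hr k hk, coeff_eq_zero_of_natDegree_lt ((hdeg d).trans_lt hk)]
    have h1 := ih (by omega) _ hlt
    have h2 := horth m d (by omega)
    rw [mul_sub, map_sub, show P m * (C (r.coeff d) * P d) = r.coeff d • (P m * P d) by
      rw [smul_eq_C_mul]; ring, map_smul, h2, smul_zero, sub_zero] at h1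
    exact h1

theorem apply_mul_of_monic_of_natDegree_eq (hmonic : ∀ n, (P n).Monic)
    (hdeg : ∀ n, (P n).natDegree = n) (horth : ∀ m n, m ≠ n → L (P m * P n) = 0)
    {m : ℕ} {r : K[X]} (hr : r.Monic) (hrdeg : r.natDegree = m) :
    L (P m * r) = L (P m * P m) := by
  rw [← sub_eq_zero, ← map_sub, ← mul_sub]
  apply orthogonal_of_degree_lt L hmonic hdeg horth
  have h1 : (P m).degree = m := by rw [degree_eq_natDegree (hmonic m).ne_zero, hdeg]
  have h2 : r.degree = m := by rw [degree_eq_natDegree hr.ne_zero, hrdeg]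
  rw [← h2]
  exact degree_sub_lt_left (h2.trans h1.symm) hr.ne_zero (by rw [hr.leadingCoeff, (hmonic m).leadingCoeff])

/-- The Christoffel–Darboux kernel `(p(z) q(y) - q(z) p(y)) / (y - z)` as a polynomial in `y`. -/
noncomputable def cdKernel (p q : K[X]) (z : K) : K[X] :=
  C (p.eval z) * (q /ₘ (X - C z)) - C (q.eval z) * (p /ₘ (X - C z))

theorem X_sub_C_mul_divByMonic_add_C_eval (f : K[X]) (z : K) :
    (X - C z) * (f /ₘ (X - C z)) + C (f.eval z) = f := by
  rw [X_sub_C_mul_divByMonic_eq_sub_modByMonic, modByMonic_X_sub_C_eq_C_eval, sub_add_cancel]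

theorem X_sub_C_mul_cdKernel (p q : K[X]) (z : K) :
    (X - C z) * cdKernel p q z = C (p.eval z) * q - C (q.eval z) * p := by
  have hp := X_sub_C_mul_divByMonic_add_C_eval p z
  have hq := X_sub_C_mul_divByMonic_add_C_eval q z
  unfold cdKernel
  linear_combination C (p.eval z) * hq - C (q.eval z) * hp

theorem degree_divByMonic_X_sub_C_lt {f : K[X]} {n : ℕ} (hf : f.degree < (n + 1 : ℕ)) (z : K) :
    (f /ₘ (X - C z)).degree < n := by
  by_cases h0 : f = 0
  · simp [h0]
  rw [degree_lt_iff_coeff_zero]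
  intro k hk
  have hn : f.natDegree < n + 1 := (natDegree_lt_iff_degree_lt h0).2 hf
  by_cases hk0 : f.natDegree = 0
  · rw [(divByMonic_eq_zero_iff (monic_X_sub_C z)).2, coeff_zero]
    rw [degree_X_sub_C, degree_eq_natDegree h0, hk0]; simp
  · apply coeff_eq_zero_of_natDegree_lt
    rw [natDegree_divByMonic f (monic_X_sub_C z), natDegree_X_sub_C]
    omega

theorem degree_cdKernel_lt {p q : K[X]} {n : ℕ} (hp : p.degree < (n + 1 : ℕ))
    (hq : q.degree < (n + 1 : ℕ)) (z : K) : (cdKernel p q z).degree < n := by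
  have h1 := degree_divByMonic_X_sub_C_lt hp z
  have h2 := degree_divByMonic_X_sub_C_lt hq z
  rw [degree_lt_iff_coeff_zero] at h1 h2 ⊢
  intro k hk
  simp [cdKernel, h1 k hk, h2 k hk]

theorem apply_cdKernel (hmonic : ∀ n, (P n).Monic) (hdeg : ∀ n, (P n).natDegree = n)
    (horth : ∀ m n, m ≠ n → L (P m * P n) = 0) (m : ℕ) (z : K) :
    L (cdKernel (P m) (P (m + 1)) z) = L (P m * P m) := by
  have hdegree n : (P n).degree = n := by rw [degree_eq_natDegree (hmonic n).ne_zero, hdeg]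
  have hp := X_sub_C_mul_divByMonic_add_C_eval (P m) z
  have hq := X_sub_C_mul_divByMonic_add_C_eval (P (m + 1)) z
  have hDp : (P m /ₘ (X - C z)).degree < m :=
    degree_divByMonic_X_sub_C_lt (by rw [hdegree]; exact_mod_cast m.lt_succ_self) z
  have h1 : L (P (m + 1) * (P m /ₘ (X - C z))) = 0 :=
    orthogonal_of_degree_lt L hmonic hdeg horth
      (hDp.trans (by exact_mod_cast m.lt_succ_self))
  have h2 : L (P m * (P (m + 1) /ₘ (X - C z))) = L (P m * P m) := by
    apply apply_mul_of_monic_of_natDegree_eq L hmonic hdeg horth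
    · rw [Monic, leadingCoeff_divByMonic_X_sub_C, hmonic]
      rw [hdegree]; exact_mod_cast m.succ_ne_zero
    · rw [natDegree_divByMonic _ (monic_X_sub_C z), natDegree_X_sub_C, hdeg, Nat.add_sub_cancel]
  have h3 : P m * (P (m + 1) /ₘ (X - C z)) =
      cdKernel (P m) (P (m + 1)) z + P (m + 1) * (P m /ₘ (X - C z)) := by
    unfold cdKernel
    linear_combination (P m /ₘ (X - C z)) * hq - (P (m + 1) /ₘ (X - C z)) * hp
  rw [← h2, h3, map_add, h1, add_zero]

theorem apply_cdKernel_mul (hmonic : ∀ n, (P n).Monic) (hdeg : ∀ n, (P n).natDegree = n)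
    (horth : ∀ m n, m ≠ n → L (P m * P n) = 0) {m : ℕ} (z : K) {s : K[X]}
    (hs : s.degree < (m + 1 : ℕ)) :
    L (cdKernel (P m) (P (m + 1)) z * s) = s.eval z * L (P m * P m) := by
  have hDs := degree_divByMonic_X_sub_C_lt hs z
  have h1 : L (P m * (s /ₘ (X - C z))) = 0 :=
    orthogonal_of_degree_lt L hmonic hdeg horth hDs
  have h2 : L (P (m + 1) * (s /ₘ (X - C z))) = 0 :=
    orthogonal_of_degree_lt L hmonic hdeg horth
      (hDs.trans (by exact_mod_cast m.lt_succ_self))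
  have h3 : cdKernel (P m) (P (m + 1)) z * s =
      s.eval z • cdKernel (P m) (P (m + 1)) z +
        ((P m).eval z • (P (m + 1) * (s /ₘ (X - C z))) -
          (P (m + 1)).eval z • (P m * (s /ₘ (X - C z)))) := by
    simp only [smul_eq_C_mul]
    linear_combination (s /ₘ (X - C z)) * X_sub_C_mul_cdKernel (P m) (P (m + 1)) z -
      cdKernel (P m) (P (m + 1)) z * X_sub_C_mul_divByMonic_add_C_eval s z
  simp [h3, h1, h2, apply_cdKernel L hmonic hdeg horth]

theorem apply_two_mul_X_mul_sub_derivative_cdKernel (hmonic : ∀ n, (P n).Monic)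
    (hdeg : ∀ n, (P n).natDegree = n) (horth : ∀ m n, m ≠ n → L (P m * P n) = 0)
    (m : ℕ) (z : K) :
    L (2 * X * (cdKernel (P m) (P (m + 1)) z * P m) -
        derivative (cdKernel (P m) (P (m + 1)) z * P m)) =
      (2 * (z * (P m).eval z - (P (m + 1)).eval z) - (derivative (P m)).eval z) *
        L (P m * P m) := by
  have hdegree n : (P n).degree = n := by rw [degree_eq_natDegree (hmonic n).ne_zero, hdeg]
  set G := cdKernel (P m) (P (m + 1)) z with hG
  have hGdeg : G.degree < (m + 1 : ℕ) :=
    degree_cdKernel_lt (by rw [hdegree]; exact_mod_cast (by omega))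
      (by rw [hdegree]; exact_mod_cast (by omega)) z
  have hG'deg : (derivative G).degree < m := by
    rw [degree_lt_iff_coeff_zero] at hGdeg ⊢
    intro k hk
    simp [coeff_derivative, hGdeg (k + 1) (by omega)]
  have h1 : L (P (m + 1) * G) = 0 := orthogonal_of_degree_lt L hmonic hdeg horth hGdeg
  have h2 : L (P m * derivative G) = 0 := orthogonal_of_degree_lt L hmonic hdeg horth hG'deg
  have h3 : L (G * derivative (P m)) = (derivative (P m)).eval z * L (P m * P m) :=
    apply_cdKernel_mul L hmonic hdeg horth z
      (degree_derivative_le.trans_lt (by rw [hdegree]; exact_mod_cast m.lt_succ_self))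
  have h4 : L (G * (X * P m - P (m + 1))) =
      (z * (P m).eval z - (P (m + 1)).eval z) * L (P m * P m) := by
    rw [hG, apply_cdKernel_mul L hmonic hdeg horth z]
    · simp
    · have hX : (X * P m).Monic := monic_X.mul (hmonic m)
      have hXdeg : (X * P m).degree = ((m + 1 : ℕ) : WithBot ℕ) := by
        rw [mul_comm, degree_mul_X, hdegree]; simp
      rw [← hXdeg]
      exact degree_sub_lt_left (hXdeg.trans (hdegree _).symm) hX.ne_zero
        (by rw [hX.leadingCoeff, (hmonic _).leadingCoeff])
  have h5 : 2 * X * (G * P m) - derivative (G * P m) =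
      (2 : K) • (G * (X * P m - P (m + 1))) + (2 : K) • (P (m + 1) * G) -
        P m * derivative G - G * derivative (P m) := by
    simp only [smul_eq_C_mul, derivative_mul, map_ofNat]
    ring
  rw [h5, map_sub, map_sub, map_add, map_smul, map_smul, h1, h2, h3, h4]
  simp only [smul_eq_mul]
  ring

end OrthogonalPolynomials

/-- The Gaussian Fisher–Hartwig weight with singularities of exponent `γ j` at `t j`. -/
noncomputable def fisherHartwigWeight {ι : Type*} [Fintype ι] (t γ : ι → ℝ) (x : ℝ) : ℝ :=
  Real.exp (-x ^ 2) * ∏ j, |x - t j| ^ γ j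

theorem abs_rpow_le_one_add_pow_s1 (a : ℝ) {g : ℝ} (hg : 0 < g) :
    |a| ^ g ≤ 1 + a ^ (2 * ⌈g⌉₊) := by
  have h0 : 0 ≤ a ^ (2 * ⌈g⌉₊) := (even_two_mul _).pow_nonneg a
  rcases le_total |a| 1 with h | h
  · linarith [Real.rpow_le_one (abs_nonneg a) h hg.le]
  · have h1 : |a| ^ g ≤ |a| ^ ((2 * ⌈g⌉₊ : ℕ) : ℝ) := by
      apply Real.rpow_le_rpow_of_exponent_le h
      have := Nat.le_ceil g
      push_cast
      linarith
    rw [Real.rpow_natCast, (even_two_mul _).pow_abs] at h1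
    linarith

theorem integrable_eval_mul_exp_neg_sq (f : ℝ[X]) :
    Integrable fun x : ℝ => f.eval x * Real.exp (-x ^ 2) := by
  induction f using Polynomial.induction_on' with
  | add p q hp hq =>
    simp only [eval_add, add_mul]
    exact hp.add hq
  | monomial n a =>
    have := (integrable_rpow_mul_exp_neg_mul_sq one_pos (s := n)
      (by linarith [n.cast_nonneg (α := ℝ)])).const_mul a
    simpa [mul_assoc] using this

section FisherHartwig

variable {ι : Type*} [Fintype ι] {t γ : ι → ℝ}

theorem continuous_fisherHartwigWeight (hγ : ∀ j, 0 < γ j) :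
    Continuous (fisherHartwigWeight t γ) := by
  unfold fisherHartwigWeight
  refine Continuous.mul (by fun_prop) (continuous_finsetProd _ fun j _ => ?_)
  exact Continuous.rpow_const (by fun_prop) fun x => Or.inr (hγ j).le

theorem fisherHartwigWeight_nonneg (x : ℝ) : 0 ≤ fisherHartwigWeight t γ x := by
  unfold fisherHartwigWeight
  positivity

theorem fisherHartwigWeight_le (hγ : ∀ j, 0 < γ j) (x : ℝ) :
    fisherHartwigWeight t γ x ≤
      (∏ j, (1 + (X - C (t j)) ^ (2 * ⌈γ j⌉₊))).eval x * Real.exp (-x ^ 2) := by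
  rw [fisherHartwigWeight, mul_comm, eval_prod]
  gcongr with j
  simpa using abs_rpow_le_one_add_pow_s1 (x - t j) (hγ j)

theorem integrable_pow_mul_fisherHartwigWeight (hγ : ∀ j, 0 < γ j) (n : ℕ) :
    Integrable fun x : ℝ => x ^ n * fisherHartwigWeight t γ x := by
  refine (integrable_eval_mul_exp_neg_sq
    ((1 + X ^ 2) ^ n * ∏ j, (1 + (X - C (t j)) ^ (2 * ⌈γ j⌉₊)))).mono'
    ((continuous_pow n).mul (continuous_fisherHartwigWeight hγ)).aestronglyMeasurable
    (ae_of_all _ fun x => ?_)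
  have h1 : |x| ^ n ≤ (1 + x ^ 2) ^ n := by
    gcongr
    nlinarith [sq_nonneg (|x| - 1), sq_abs x, abs_nonneg x]
  rw [Real.norm_eq_abs, abs_mul, abs_pow, abs_of_nonneg (fisherHartwigWeight_nonneg x), eval_mul,
    mul_assoc]
  have h2 : ((1 + X ^ 2) ^ n : ℝ[X]).eval x = (1 + x ^ 2) ^ n := by simp
  rw [h2]
  exact mul_le_mul h1 (fisherHartwigWeight_le hγ x) (fisherHartwigWeight_nonneg x) (by positivity)

theorem integrable_eval_mul_fisherHartwigWeight (hγ : ∀ j, 0 < γ j) (f : ℂ[X]) :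
    Integrable fun x : ℝ => f.eval (x : ℂ) * (fisherHartwigWeight t γ x : ℂ) := by
  induction f using Polynomial.induction_on' with
  | add p q hp hq =>
    simp only [eval_add, add_mul]
    exact hp.add hq
  | monomial n a =>
    have := ((integrable_pow_mul_fisherHartwigWeight (t := t) hγ n).ofReal (𝕜 := ℂ)).const_mul a
    simpa [mul_assoc] using this

theorem integrableOn_abs_rpow_sub_one {g : ℝ} (hg : 0 < g) (c : ℝ) :
    IntegrableOn (fun x : ℝ => |x - c| ^ (g - 1)) (Set.Icc (c - 1) (c + 1)) := by
  have h1 : IntervalIntegrable (fun x : ℝ => |x| ^ (g - 1)) volume 0 1 := by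
    refine (intervalIntegral.intervalIntegrable_rpow' (by linarith : -1 < g - 1)).congr ?_
    intro x hx
    rw [Set.uIoc_of_le zero_le_one] at hx
    simp [abs_of_pos hx.1]
  have h2 : IntervalIntegrable (fun x : ℝ => |x| ^ (g - 1)) volume (-1) 0 := by
    rw [IntervalIntegrable.iff_comp_neg]
    simpa using h1.symm
  have h3 := (h2.trans h1).comp_sub_right c
  rw [intervalIntegrable_iff_integrableOn_Icc_of_le (by linarith)] at h3
  rwa [show c - 1 = -1 + c by ring, add_comm c 1]

theorem integrable_eval_mul_fisherHartwigWeight_div (hγ : ∀ j, 0 < γ j) (f : ℂ[X]) (j : ι) :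
    Integrable fun x : ℝ =>
      f.eval (x : ℂ) * (fisherHartwigWeight t γ x : ℂ) / ((x : ℂ) - (t j : ℂ)) := by
  classical
  have hmeas : AEStronglyMeasurable (fun x : ℝ =>
      f.eval (x : ℂ) * (fisherHartwigWeight t γ x : ℂ) / ((x : ℂ) - (t j : ℂ))) := by
    have := (continuous_fisherHartwigWeight (t := t) hγ).measurable
    have hf : Measurable fun x : ℝ => f.eval (x : ℂ) :=
      (f.continuous.comp Complex.continuous_ofReal).measurable
    exact (by fun_prop : Measurable _).aestronglyMeasurable
  rw [← integrableOn_univ, ← Set.union_compl_self (Set.Icc (t j - 1) (t j + 1))]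
  refine IntegrableOn.union ?_ ?_
  · have hcont : Continuous fun x : ℝ => ‖f.eval (x : ℂ)‖ *
        (Real.exp (-x ^ 2) * ∏ i ∈ Finset.univ.erase j, |x - t i| ^ γ i) := by
      refine Continuous.mul (by fun_prop) (Continuous.mul (by fun_prop)
        (continuous_finsetProd _ fun i _ => ?_))
      exact Continuous.rpow_const (by fun_prop) fun x => Or.inr (hγ i).le
    refine Integrable.mono' ((integrableOn_abs_rpow_sub_one (hγ j) (t j)).continuousOn_mul
      hcont.continuousOn isCompact_Icc) hmeas.restrict (ae_of_all _ fun x => ?_)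
    by_cases hx : x = t j
    · simp only [hx, sub_self, div_zero, norm_zero]
      positivity
    have hpos : 0 < |x - t j| := abs_pos.2 (sub_ne_zero.2 hx)
    rw [norm_div, norm_mul, Complex.norm_real, Real.norm_of_nonneg (fisherHartwigWeight_nonneg x),
      ← Complex.ofReal_sub, Complex.norm_real, Real.norm_eq_abs, Real.rpow_sub_one hpos.ne',
      fisherHartwigWeight, ← Finset.mul_prod_erase _ _ (Finset.mem_univ j)]
    apply le_of_eq
    ring
  · refine Integrable.mono (integrable_eval_mul_fisherHartwigWeight (t := t) hγ f).integrableOn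
      hmeas.restrict ((ae_restrict_iff' measurableSet_Icc.compl).2 (ae_of_all _ fun x hx => ?_))
    have h1 : 1 ≤ |x - t j| := by
      by_contra! h
      rw [abs_lt] at h
      exact hx ⟨by linarith, by linarith⟩
    rw [norm_div, ← Complex.ofReal_sub, Complex.norm_real (x - t j), Real.norm_eq_abs]
    exact div_le_self (norm_nonneg _) h1

theorem hasDerivAt_fisherHartwigWeight {x : ℝ} (hx : ∀ j, x ≠ t j) :
    HasDerivAt (fisherHartwigWeight t γ)
      (fisherHartwigWeight t γ x * (-(2 * x) + ∑ j, γ j / (x - t j))) x := by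
  have key (y : ℝ) (hy : ∀ j, y ≠ t j) : fisherHartwigWeight t γ y =
      Real.exp (-y ^ 2 + ∑ j, γ j * Real.log (y - t j)) := by
    rw [Real.exp_add, Real.exp_sum, fisherHartwigWeight]
    congr 1
    refine Finset.prod_congr rfl fun j _ => ?_
    rw [Real.rpow_def_of_pos (abs_pos.2 (sub_ne_zero.2 (hy j))), Real.log_abs, mul_comm]
  have hev : fisherHartwigWeight t γ =ᶠ[nhds x]
      fun y => Real.exp (-y ^ 2 + ∑ j, γ j * Real.log (y - t j)) := by
    have : ∀ᶠ y in nhds x, ∀ j, y ≠ t j :=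
      Filter.eventually_all.2 fun j => isOpen_ne.mem_nhds (hx j)
    filter_upwards [this] with y hy using key y hy
  refine HasDerivAt.congr_of_eventuallyEq ?_ hev
  rw [key x hx]
  refine HasDerivAt.exp (HasDerivAt.add ?_ (HasDerivAt.fun_sum fun j _ => ?_))
  · simpa using (hasDerivAt_pow 2 x).fun_neg
  · have := (((hasDerivAt_id x).sub_const (t j)).log (sub_ne_zero.2 (hx j))).const_mul (γ j)
    simpa [div_eq_mul_inv] using this

theorem integral_eq_zero_of_hasDerivAt_off_finite {E : Type*} [NormedAddCommGroup E]
    [NormedSpace ℝ E] [CompleteSpace E] {F F' : ℝ → E} {s : Set ℝ} (hs : s.Finite)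
    (hF : Continuous F) (hderiv : ∀ x ∉ s, HasDerivAt F (F' x) x) (hF' : Integrable F')
    (hFint : Integrable F) : ∫ x, F' x = 0 := by
  obtain ⟨b, hb⟩ := hs.bddAbove
  obtain ⟨a, ha⟩ := hs.bddBelow
  have htop : Filter.Tendsto F Filter.atTop (nhds 0) :=
    tendsto_zero_of_hasDerivAt_of_integrableOn_Ioi (a := b)
      (fun x hx => hderiv x fun h => absurd (hb h) (not_le.2 hx)) hF'.integrableOn
      hFint.integrableOn
  have hbot : Filter.Tendsto F Filter.atBot (nhds 0) :=
    tendsto_zero_of_hasDerivAt_of_integrableOn_Iic (a := a - 1)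
      (fun x hx => hderiv x fun h => by linarith [ha h, Set.mem_Iic.1 hx]) hF'.integrableOn
      hFint.integrableOn
  have hlim := intervalIntegral_tendsto_integral hF' Filter.tendsto_neg_atTop_atBot Filter.tendsto_id
  have hlim' := (htop.sub (hbot.comp Filter.tendsto_neg_atTop_atBot))
  rw [sub_zero] at hlim'
  refine tendsto_nhds_unique hlim (hlim'.congr fun r => ?_)
  exact (integral_eq_of_hasDerivAt_off_countable F F' hs.countable hF.continuousOn
    (fun x hx => hderiv x hx.2) hF'.intervalIntegrable).symm

theorem sum_mul_integral_div_eq (hγ : ∀ j, 0 < γ j) (f : ℂ[X]) :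
    ∑ j, (γ j : ℂ) * ∫ x : ℝ,
        f.eval (x : ℂ) * (fisherHartwigWeight t γ x : ℂ) / ((x : ℂ) - (t j : ℂ)) =
      ∫ x : ℝ, (2 * X * f - derivative f).eval (x : ℂ) * (fisherHartwigWeight t γ x : ℂ) := by
  have hint j := (integrable_eval_mul_fisherHartwigWeight_div (t := t) hγ f j).const_mul (γ j : ℂ)
  have hint' := integrable_eval_mul_fisherHartwigWeight (t := t) hγ (2 * X * f - derivative f)
  simp_rw [← integral_const_mul]
  rw [← integral_finsetSum _ fun j _ => hint j, ← sub_eq_zero,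
    ← integral_sub (integrable_finsetSum _ fun j _ => hint j) hint']
  refine integral_eq_zero_of_hasDerivAt_off_finite
    (F := fun x : ℝ => f.eval (x : ℂ) * (fisherHartwigWeight t γ x : ℂ)) (Set.finite_range t)
    ?_ ?_ ((integrable_finsetSum _ fun j _ => hint j).sub hint')
    (integrable_eval_mul_fisherHartwigWeight hγ f)
  · have := continuous_fisherHartwigWeight (t := t) hγ
    fun_prop
  · intro x hx
    have hx' j : x ≠ t j := fun h => hx ⟨j, h.symm⟩
    have h1 := (f.hasDerivAt (x : ℂ)).comp_ofReal
    have h2 := (hasDerivAt_fisherHartwigWeight (γ := γ) hx').ofReal_comp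
    refine (h1.fun_mul h2).congr_deriv (Eq.symm ?_)
    simp only [eval_sub, eval_mul, eval_X, eval_ofNat, Complex.ofReal_mul, Complex.ofReal_add,
      Complex.ofReal_neg, Complex.ofReal_sum, Complex.ofReal_div, Complex.ofReal_sub,
      Complex.ofReal_ofNat]
    rw [mul_add, mul_add, Finset.mul_sum, Finset.mul_sum]
    have : ∑ j, (γ j : ℂ) * (f.eval (x : ℂ) * (fisherHartwigWeight t γ x : ℂ) /
        ((x : ℂ) - (t j : ℂ))) = ∑ j, f.eval (x : ℂ) *
        ((fisherHartwigWeight t γ x : ℂ) * ((γ j : ℂ) / ((x : ℂ) - (t j : ℂ)))) :=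
      Finset.sum_congr rfl fun j _ => by ring
    rw [this]
    ring

/-- Integration of complex polynomials against the Fisher–Hartwig weight. -/
noncomputable def fisherHartwigFunctional (t : ι → ℝ) (hγ : ∀ j, 0 < γ j) : ℂ[X] →ₗ[ℂ] ℂ where
  toFun f := ∫ x : ℝ, f.eval (x : ℂ) * (fisherHartwigWeight t γ x : ℂ)
  map_add' f g := by
    simp only [eval_add, add_mul]
    exact integral_add (integrable_eval_mul_fisherHartwigWeight hγ f)
      (integrable_eval_mul_fisherHartwigWeight hγ g)
  map_smul' c f := by
    simp only [eval_smul, smul_eq_mul, mul_assoc, integral_const_mul, RingHom.id_apply]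

theorem fisherHartwigFunctional_apply (hγ : ∀ j, 0 < γ j) (f : ℂ[X]) :
    fisherHartwigFunctional t hγ f =
      ∫ x : ℝ, f.eval (x : ℂ) * (fisherHartwigWeight t γ x : ℂ) := rfl

theorem fisherHartwigFunctional_map (hγ : ∀ j, 0 < γ j) (f : ℝ[X]) :
    fisherHartwigFunctional t hγ (f.map (algebraMap ℝ ℂ)) =
      ((∫ x : ℝ, f.eval x * fisherHartwigWeight t γ x : ℝ) : ℂ) := by
  rw [fisherHartwigFunctional_apply, ← integral_complex_ofReal]
  congr 1 with x
  have : (f.map (algebraMap ℝ ℂ)).eval (x : ℂ) = ((f.eval x : ℝ) : ℂ) := eval_map_apply (algebraMap ℝ ℂ) x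
  rw [this, Complex.ofReal_mul]

theorem integrable_eval_mul_fisherHartwigWeight_div_mul (hγ : ∀ j, 0 < γ j) (f : ℂ[X]) (j : ι)
    {z : ℂ} (hz : z.im ≠ 0) :
    Integrable fun x : ℝ => f.eval (x : ℂ) * (fisherHartwigWeight t γ x : ℂ) /
      (((x : ℂ) - (t j : ℂ)) * (z - (x : ℂ))) := by
  have hne (x : ℝ) : z - (x : ℂ) ≠ 0 := fun h => hz (by simpa using congrArg Complex.im h)
  have hcont : Continuous fun x : ℝ => (z - (x : ℂ))⁻¹ :=
    Continuous.inv₀ (by fun_prop) hne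
  have := (integrable_eval_mul_fisherHartwigWeight_div (t := t) hγ f j).bdd_mul (c := |z.im|⁻¹)
    hcont.aestronglyMeasurable (ae_of_all _ fun x => ?_)
  · refine this.congr (ae_of_all _ fun x => ?_)
    simp only [div_eq_mul_inv, mul_inv]
    ring
  · rw [norm_inv]
    gcongr
    simpa using Complex.abs_im_le_norm (z - (x : ℂ))

end FisherHartwig

theorem raising_operator
    (N : ℕ) (hN : 1 ≤ N)
    (t γ : Fin N → ℝ) (ht : Function.Injective t) (hγ : ∀ j, 0 < γ j)
    (w : ℝ → ℝ) (hw : ∀ x : ℝ, w x = Real.exp (-x ^ 2) * ∏ j, |x - t j| ^ γ j)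
    (P : ℕ → Polynomial ℝ)
    (hPmonic : ∀ n, (P n).Monic) (hPdeg : ∀ n, (P n).natDegree = n)
    (horth : ∀ m n, m ≠ n → ∫ x : ℝ, (P m).eval x * (P n).eval x * w x = 0)
    (h : ℕ → ℝ) (hh : ∀ n, h n = ∫ x : ℝ, ((P n).eval x) ^ 2 * w x)
    (hhpos : ∀ n, 0 < h n)
    (β : ℕ → ℝ) (hβ0 : β 0 = 0) (hβ : ∀ n, β (n + 1) = h (n + 1) / h n)
    (α : ℕ → ℝ) (hα : ∀ n, α n = (∫ x : ℝ, x * ((P n).eval x) ^ 2 * w x) / h n)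
    (A B : ℕ → ℂ → ℂ)
    (hA : ∀ n (z : ℂ), A n z = 2 + ∑ j, ((γ j / h n : ℝ) : ℂ) *
      ∫ y : ℝ, (Complex.ofReal ((P n).eval y)) ^ 2 * (w y : ℂ) / (((y : ℂ) - (t j : ℂ)) * (z - (y : ℂ))))
    (hB0 : ∀ z : ℂ, B 0 z = 0)
    (hB : ∀ n (z : ℂ), B (n + 1) z = ∑ j, ((γ j / h n : ℝ) : ℂ) *
      ∫ y : ℝ, (Complex.ofReal ((P (n + 1)).eval y)) * (Complex.ofReal ((P n).eval y)) * (w y : ℂ) / (((y : ℂ) - (t j : ℂ)) * (z - (y : ℂ))))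
    (n : ℕ) (hn : 1 ≤ n) (z : ℂ) (hz : z.im ≠ 0) :
    Polynomial.aeval z (Polynomial.derivative (P (n - 1))) - (B n z + 2 * z) * Polynomial.aeval z (P (n - 1))
      = -(A (n - 1) z * Polynomial.aeval z (P n)) := by
  obtain ⟨m, rfl⟩ : ∃ m, n = m + 1 := ⟨n - 1, by omega⟩
  have hw' : w = fisherHartwigWeight t γ := funext hw
  subst hw'
  simp only [Nat.add_sub_cancel]
  let L := fisherHartwigFunctional t hγ
  let Q : ℕ → ℂ[X] := fun k => (P k).map (algebraMap ℝ ℂ)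
  have hQmonic k : (Q k).Monic := (hPmonic k).map _
  have hQdeg k : (Q k).natDegree = k := by rw [(hPmonic k).natDegree_map, hPdeg]
  have hL k l : L (Q k * Q l) =
      ((∫ x : ℝ, (P k).eval x * (P l).eval x * fisherHartwigWeight t γ x : ℝ) : ℂ) := by
    simp only [L, Q, ← Polynomial.map_mul, fisherHartwigFunctional_map, eval_mul]
  have hQorth k l (hkl : k ≠ l) : L (Q k * Q l) = 0 := by
    rw [hL, horth k l hkl, Complex.ofReal_zero]
  have hLh : L (Q m * Q m) = (h m : ℂ) := by
    rw [hL, hh]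
    simp only [pow_two]
  have hm : (h m : ℂ) ≠ 0 := Complex.ofReal_ne_zero.2 (hhpos m).ne'
  have heval k (x : ℝ) : (Q k).eval (x : ℂ) = (((P k).eval x : ℝ) : ℂ) :=
    eval_map_apply (algebraMap ℝ ℂ) x
  have hne (x : ℝ) : z - (x : ℂ) ≠ 0 := fun h => hz (by simpa using congrArg Complex.im h)
  have hterm j :
      (Q (m + 1)).eval z * (∫ y : ℝ, (Complex.ofReal ((P m).eval y)) ^ 2 *
        (fisherHartwigWeight t γ y : ℂ) / (((y : ℂ) - (t j : ℂ)) * (z - (y : ℂ)))) -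
      (Q m).eval z * (∫ y : ℝ, (Complex.ofReal ((P (m + 1)).eval y)) *
        (Complex.ofReal ((P m).eval y)) * (fisherHartwigWeight t γ y : ℂ) /
          (((y : ℂ) - (t j : ℂ)) * (z - (y : ℂ)))) =
      ∫ y : ℝ, (cdKernel (Q m) (Q (m + 1)) z * Q m).eval (y : ℂ) *
        (fisherHartwigWeight t γ y : ℂ) / ((y : ℂ) - (t j : ℂ)) := by
    have h1 := integrable_eval_mul_fisherHartwigWeight_div_mul (t := t) hγ (Q m ^ 2) j hz
    have h2 := integrable_eval_mul_fisherHartwigWeight_div_mul (t := t) hγ (Q (m + 1) * Q m) j hz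
    simp only [eval_pow, eval_mul, heval] at h1 h2 ⊢
    rw [← integral_const_mul, ← integral_const_mul,
      ← integral_sub (h1.const_mul _) (h2.const_mul _)]
    congr 1 with y
    have h3 := congrArg (eval (y : ℂ)) (X_sub_C_mul_cdKernel (Q m) (Q (m + 1)) z)
    simp only [eval_mul, eval_sub, eval_X, eval_C, heval] at h3
    rw [mul_div_assoc', mul_div_assoc', ← sub_div,
      ← mul_div_mul_right _ ((y : ℂ) - (t j : ℂ)) (hne y)]
    congr 1
    linear_combination
      (Complex.ofReal ((P m).eval y) * (fisherHartwigWeight t γ y : ℂ)) * h3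
  have hsum := sum_mul_integral_div_eq (t := t) hγ (cdKernel (Q m) (Q (m + 1)) z * Q m)
  rw [← fisherHartwigFunctional_apply hγ,
    apply_two_mul_X_mul_sub_derivative_cdKernel _ hQmonic hQdeg hQorth, hLh] at hsum
  simp only [← hterm] at hsum
  have hP k : aeval z (P k) = (Q k).eval z := by rw [aeval_def, eval_map]
  have hP' : aeval z (derivative (P m)) = (derivative (Q m)).eval z := by
    rw [aeval_def, ← eval_map, ← derivative_map]
  rw [hP, hP, hP']
  have hdiv : (Q (m + 1)).eval z * (A m z - 2) - (Q m).eval z * B (m + 1) z =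
      2 * (z * (Q m).eval z - (Q (m + 1)).eval z) - (derivative (Q m)).eval z := by
    rw [← mul_left_inj' hm, ← hsum, hA, hB, add_sub_cancel_left, Finset.mul_sum, Finset.mul_sum,
      ← Finset.sum_sub_distrib, Finset.sum_mul]
    refine Finset.sum_congr rfl fun j _ => ?_
    rw [Complex.ofReal_div]
    field_simp
  linear_combination hdiv
end
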